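/- Let n ≥ 2. Let U_q^+(sl_3) be the ℂ(q)-algebra presented by generators E_1, E_2 and the relations E_i²E_j − (q+q^{−1})E_iE_jE_i + E_jE_i² = 0 for {i,j}={1,2}, let A be its n-fold tensor power algebra over ℂ(q), and define E_{12,i}, E_{21,i}, Y_{1,n}, Y_{2,n}, Z_{k,n} ∈ A as follows: E_{12,i} = (q−q^{−1})^{−1}(E_{2,i}E_{1,i} − q^{−1}E_{1,i}E_{2,i}), E_{21,i} = (q−q^{−1})^{−1}(E_{1,i}E_{2,i} − q^{−1}E_{2,i}E_{1,i}) in the i-th factor, Y_{1,n}=E_{1,1}⋯E_{1,n}, Y_{2,n}=E_{2,1}⋯E_{2,n}, Z_{0,1}=E_{21,1}, Z_{1,1}=E_{12,1}, Z_{i,k} = Z_{i,k−1}E_{21,k} + Z_{i−1,k−1}E_{12,k}. Let 𝒜^{(n)}_{q,3} be the ℂ(q)-algebra presented by generators u_1, u_2, z_1,…,z_{n−1} and relations: z_kz_l=z_lz_k; u_i z_{k,i}=q^{n−2k}z_{k,i}u_i for i=1,2 (where z_{k,1}=z_k, z_{k,2}=z_{n−k}); and u_i²u_j−(q^n+q^{−n})u_iu_ju_i+u_ju_i²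 = (q^{−1}−q)u_iΣ_{k=1}^{n−1}q^k z_{k,i} for {i,j}={1,2}. Then the assignment u_1 ↦ Y_{1,n}, u_2 ↦ Y_{2,n}, z_k ↦ [k]_q (q^{n−k}−q^{k−n}) Z_{k,n} extends to a ℂ(q)-algebra homomorphism 𝒜^{(n)}_{q,3} → A, where [k]_q = (q^k−q^{−k})/(q−q^{−1}). -/

import Mathlib

set_option synthInstance.maxHeartbeats 1000000
set_option maxHeartbeats 1000000

noncomputable section
open scoped TensorProduct

/-- The field `ℂ(q)` of rational functions. -/
abbrev Kq := RatFunc ℂ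
/-- The variable `q`. -/
def qq : Kq := RatFunc.X

/-- The defining (quantum Serre) relations of `U_q^+(sl₃)` on the generators `E₁, E₂`
(indexed by `Fin 2`). -/
inductive SL3Rel : FreeAlgebra Kq (Fin 2) → FreeAlgebra Kq (Fin 2) → Prop
  | serre (i j : Fin 2) : i ≠ j →
      SL3Rel (FreeAlgebra.ι Kq i * FreeAlgebra.ι Kq i * FreeAlgebra.ι Kq j
          + FreeAlgebra.ι Kq j * FreeAlgebra.ι Kq i * FreeAlgebra.ι Kq i)
        ((qq + qq⁻¹) • (FreeAlgebra.ι Kq i * FreeAlgebra.ι Kq j * FreeAlgebra.ι Kq i))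

/-- `U_q^+(sl₃)`. -/
abbrev UqSL3 := RingQuot SL3Rel

/-- The generators `E₁, E₂` of `U_q^+(sl₃)`. -/
def Egen (i : Fin 2) : UqSL3 := RingQuot.mkAlgHom Kq SL3Rel (FreeAlgebra.ι Kq i)

variable (n : ℕ)

/-- The `n`-fold tensor power algebra `U_q^+(sl₃)^{⊗n}`. -/
abbrev TP (n : ℕ) := ⨂[Kq] (_ : Fin n), UqSL3

/-- The image of `x ∈ U_q^+(sl₃)` in the `k`-th tensor factor (`1 ≤ k ≤ n`). -/
def emb (x : UqSL3) (k : ℕ) : TP n :=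
  PiTensorProduct.tprod Kq (fun j : Fin n => if (j : ℕ) + 1 = k then x else 1)

/-- `E_{1,k}`. -/
def E1i (k : ℕ) : TP n := emb n (Egen 0) k
/-- `E_{2,k}`. -/
def E2i (k : ℕ) : TP n := emb n (Egen 1) k
/-- `E_{12,k} = (q−q⁻¹)⁻¹ (E_{2,k}E_{1,k} − q⁻¹E_{1,k}E_{2,k})`. -/
def E12i (k : ℕ) : TP n := (qq - qq⁻¹)⁻¹ • (E2i n k * E1i n k - qq⁻¹ • (E1i n k * E2i n k))
/-- `E_{21,k} = (q−q⁻¹)⁻¹ (E_{1,k}E_{2,k} − q⁻¹E_{2,k}E_{1,k})`. -/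
def E21i (k : ℕ) : TP n := (qq - qq⁻¹)⁻¹ • (E1i n k * E2i n k - qq⁻¹ • (E2i n k * E1i n k))

/-- `Y_{1,k} = E_{1,1} ⋯ E_{1,k}`. -/
def Y1 : TP n := (List.ofFn fun j : Fin n => E1i n ((j : ℕ) + 1)).prod
/-- `Y_{2,k} = E_{2,1} ⋯ E_{2,k}`. -/
def Y2 : TP n := (List.ofFn fun j : Fin n => E2i n ((j : ℕ) + 1)).prod

/-- The elements `Z_{i,k}`, defined by `Z_{0,1} = E_{21,1}`, `Z_{1,1} = E_{12,1}` and the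
recursion `Z_{i,k} = Z_{i,k−1}E_{21,k} + Z_{i−1,k−1}E_{12,k}` (`Z_{i,k} = 0` for `i < 0` or
`i > k`). -/
def Zel : ℕ → ℕ → TP n
  | _, 0 => 0
  | 0, 1 => E21i n 1
  | 1, 1 => E12i n 1
  | _ + 2, 1 => 0
  | 0, k + 2 => Zel 0 (k + 1) * E21i n (k + 2)
  | i + 1, k + 2 => Zel (i + 1) (k + 1) * E21i n (k + 2) + Zel i (k + 1) * E12i n (k + 2)

/-- Generators `u₁, u₂, z_1, …, z_{n−1}` of `𝒜^{(n)}_{q,3}`; `z k` stands for `z_{k+1}`. -/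
inductive AGen (n : ℕ)
  | u1
  | u2
  | z (k : Fin (n - 1))

/-- `u₁` in the free algebra. -/
def au1 : FreeAlgebra Kq (AGen n) := FreeAlgebra.ι Kq AGen.u1
/-- `u₂` in the free algebra. -/
def au2 : FreeAlgebra Kq (AGen n) := FreeAlgebra.ι Kq AGen.u2
/-- `z_{k+1}` in the free algebra. -/
def az (k : Fin (n - 1)) : FreeAlgebra Kq (AGen n) := FreeAlgebra.ι Kq (AGen.z k)

/-- The defining relations of `𝒜^{(n)}_{q,3}`: the `z_k` commute;
`u_i z_{k,i} = q^{n−2k} z_{k,i} u_i` (`i = 1, 2`), where `z_{k,1} = z_k`, `z_{k,2} = z_{n−k}`;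
and `u_i²u_j − (qⁿ+q⁻ⁿ)u_iu_ju_i + u_ju_i² = (q⁻¹−q)u_i ∑_{k=1}^{n−1} q^k z_{k,i}` for
`{i,j} = {1,2}`. -/
inductive ARel (n : ℕ) : FreeAlgebra Kq (AGen n) → FreeAlgebra Kq (AGen n) → Prop
  | comm_z (k l : Fin (n - 1)) : ARel n (az n k * az n l) (az n l * az n k)
  | u1z (k : Fin (n - 1)) :
      ARel n (au1 n * az n k)
        (qq ^ ((n : ℤ) - 2 * ((k : ℕ) + 1)) • (az n k * au1 n))
  | u2z (k l : Fin (n - 1)) : ((k : ℕ) + 1) + ((l : ℕ) + 1) = n →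
      ARel n (au2 n * az n l)
        (qq ^ ((n : ℤ) - 2 * ((k : ℕ) + 1)) • (az n l * au2 n))
  | serre1 :
      ARel n (au1 n * au1 n * au2 n + au2 n * au1 n * au1 n)
        ((qq ^ n + qq⁻¹ ^ n) • (au1 n * au2 n * au1 n)
          + (qq⁻¹ - qq) • (au1 n * ∑ k : Fin (n - 1), qq ^ ((k : ℕ) + 1) • az n k))
  | serre2 :
      ARel n (au2 n * au2 n * au1 n + au1 n * au2 n * au2 n)
        ((qq ^ n + qq⁻¹ ^ n) • (au2 n * au1 n * au2 n)
          + (qq⁻¹ - qq) • (au2 n * ∑ k : Fin (n - 1), qq ^ (n - ((k : ℕ) + 1)) • az n k))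

/-- The algebra `𝒜^{(n)}_{q,3}`. -/
abbrev Aqn (n : ℕ) := RingQuot (ARel n)

/-- The quantum integer `[k]_q = (q^k − q^{−k})/(q − q⁻¹)`. -/
def qint (k : ℕ) : Kq := (qq ^ k - qq⁻¹ ^ k) / (qq - qq⁻¹)

section Abs
variable {K A : Type*} [Field K] [Ring A] [Algebra K A]

theorem site_rels (q : K) (hq : q ≠ 0) (hc : q - q⁻¹ ≠ 0) (a b x y : A)
    (h1 : a * a * b + b * a * a = (q + q⁻¹) • (a * b * a))
    (h2 : b * b * a + a * b * b = (q + q⁻¹) • (b * a * b))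
    (hx : x = (q - q⁻¹)⁻¹ • (b * a - q⁻¹ • (a * b)))
    (hy : y = (q - q⁻¹)⁻¹ • (a * b - q⁻¹ • (b * a))) :
    a * y = q • (y * a) ∧ a * x = q⁻¹ • (x * a) ∧ b * y = q⁻¹ • (y * b) ∧
    b * x = q • (x * b) ∧ a * b = q • (y + q⁻¹ • x) ∧ b * a = y + q • x ∧ Commute x y := by
  have e1 : a * y = q • (y * a) := by
    subst hy
    simp only [mul_sub, sub_mul, mul_smul_comm, smul_mul_assoc, smul_sub, ← mul_assoc]
    linear_combination (norm := skip) (q - q⁻¹)⁻¹ • h1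
    match_scalars <;> field_simp <;> ring
  have e2 : a * x = q⁻¹ • (x * a) := by
    subst hx
    simp only [mul_sub, sub_mul, mul_smul_comm, smul_mul_assoc, smul_sub, ← mul_assoc]
    linear_combination (norm := skip) (-(q - q⁻¹)⁻¹ * q⁻¹) • h1
    match_scalars <;> field_simp <;> ring
  have e3 : b * y = q⁻¹ • (y * b) := by
    subst hy
    simp only [mul_sub, sub_mul, mul_smul_comm, smul_mul_assoc, smul_sub, ← mul_assoc]
    linear_combination (norm := skip) (-(q - q⁻¹)⁻¹ * q⁻¹) • h2
    match_scalars <;> field_simp <;> ring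
  have e4 : b * x = q • (x * b) := by
    subst hx
    simp only [mul_sub, sub_mul, mul_smul_comm, smul_mul_assoc, smul_sub, ← mul_assoc]
    linear_combination (norm := skip) (q - q⁻¹)⁻¹ • h2
    match_scalars <;> field_simp <;> ring
  have hc' : q ^ 2 - 1 ≠ 0 := by
    intro h; apply hc; field_simp; simpa using h
  refine ⟨e1, e2, e3, e4, ?_, ?_, ?_⟩
  · subst hx hy
    match_scalars <;> field_simp <;> ring
  · subst hx hy
    match_scalars <;> field_simp <;> ring
  · have k1 : Commute x (a * b) := by
      show x * (a * b) = a * b * x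
      rw [mul_assoc a, e4, mul_smul_comm, ← mul_assoc a, e2, smul_mul_assoc, smul_smul,
        mul_inv_cancel₀ hq, one_smul, mul_assoc]
    have k2 : Commute x (b * a) := by
      show x * (b * a) = b * a * x
      rw [mul_assoc b, e2, mul_smul_comm, ← mul_assoc b, e4, smul_mul_assoc, smul_smul,
        inv_mul_cancel₀ hq, one_smul, mul_assoc]
    rw [hy]
    exact (k1.sub_right (k2.smul_right _)).smul_right _

def ZZ (x y : ℕ → A) : ℕ → ℕ → A
  | 0, 0 => 1
  | _ + 1, 0 => 0
  | 0, k + 1 => ZZ x y 0 k * y k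
  | i + 1, k + 1 => ZZ x y (i + 1) k * y k + ZZ x y i k * x k

def PP (a : ℕ → A) : ℕ → A
  | 0 => 1
  | k + 1 => PP a k * a k

theorem ZZ_comm (x y : ℕ → A) (t : A) : ∀ (m : ℕ) (i : ℕ),
    (∀ j < m, Commute t (x j) ∧ Commute t (y j)) → Commute t (ZZ x y i m)
  | 0, 0, _ => by simp [ZZ]
  | 0, _ + 1, _ => by simp [ZZ]
  | m + 1, 0, h => by
    rw [ZZ]
    exact (ZZ_comm x y t m 0 fun j hj => h j (by omega)).mul_right (h m (by omega)).2
  | m + 1, i + 1, h => by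
    rw [ZZ]
    exact ((ZZ_comm x y t m (i+1) fun j hj => h j (by omega)).mul_right (h m (by omega)).2).add_right
      ((ZZ_comm x y t m i fun j hj => h j (by omega)).mul_right (h m (by omega)).1)

theorem PP_comm (a : ℕ → A) (t : A) : ∀ (m : ℕ),
    (∀ j < m, Commute t (a j)) → Commute t (PP a m)
  | 0, _ => by simp [PP]
  | m + 1, h => by
    rw [PP]
    exact (PP_comm a t m fun j hj => h j (by omega)).mul_right (h m (by omega))

theorem ZZ_zero (x y : ℕ → A) : ∀ (m i : ℕ), m < i → ZZ x y i m = 0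
  | 0, _ + 1, _ => by simp [ZZ]
  | m + 1, i + 1, h => by
    rw [ZZ, ZZ_zero x y m (i+1) (by omega), ZZ_zero x y m i (by omega)]; simp

theorem PZ (r : K) (hr : r ≠ 0) (c x y : ℕ → A) : ∀ (m : ℕ) (_ : ∀ j < m, c j * y j = r • (y j * c j))
    (_ : ∀ j < m, c j * x j = r⁻¹ • (x j * c j))
    (_ : ∀ i < m, ∀ j < m, i ≠ j → Commute (c i) (x j) ∧ Commute (c i) (y j)) (i : ℕ),
    PP c m * ZZ x y i m = r ^ ((m : ℤ) - 2 * i) • (ZZ x y i m * PP c m)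
  | 0, _, _, _, 0 => by simp [ZZ]
  | 0, _, _, _, _ + 1 => by simp [ZZ]
  | m + 1, h1, h2, h3, i => by
    have ih := PZ r hr c x y m (fun j hj => h1 j (by omega)) (fun j hj => h2 j (by omega))
      (fun i hi j hj => h3 i (by omega) j (by omega))
    have cz : ∀ i, c m * ZZ x y i m = ZZ x y i m * c m := fun i =>
      ZZ_comm x y (c m) m i fun j hj => h3 m (by omega) j (by omega) (by omega)
    have px : PP c m * x m = x m * PP c m := (PP_comm c (x m) m fun j hj =>
      ((h3 j (by omega) m (by omega) (by omega)).1).symm).eq.symm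
    have py : PP c m * y m = y m * PP c m := (PP_comm c (y m) m fun j hj =>
      ((h3 j (by omega) m (by omega) (by omega)).2).symm).eq.symm
    have ky : ∀ i, PP c m * c m * (ZZ x y i m * y m)
        = r ^ ((m : ℤ) + 1 - 2 * i) • (ZZ x y i m * y m * (PP c m * c m)) := by
      intro i
      calc PP c m * c m * (ZZ x y i m * y m) = PP c m * (c m * ZZ x y i m) * y m := by
            simp only [mul_assoc]
        _ = (PP c m * ZZ x y i m) * (c m * y m) := by rw [cz]; simp only [mul_assoc]
        _ = (r ^ ((m : ℤ) - 2 * i) * r) • (ZZ x y i m * (PP c m * y m) * c m) := by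
            rw [ih, h1 m (by omega)]
            simp only [mul_smul_comm, smul_mul_assoc, smul_smul, mul_assoc]
            rw [mul_comm r]
        _ = _ := by
            rw [py, ← zpow_add_one₀ hr]; simp only [mul_assoc]; congr 2; ring
    have kx : ∀ i, PP c m * c m * (ZZ x y i m * x m)
        = r ^ ((m : ℤ) + 1 - 2 * (i + 1)) • (ZZ x y i m * x m * (PP c m * c m)) := by
      intro i
      calc PP c m * c m * (ZZ x y i m * x m) = PP c m * (c m * ZZ x y i m) * x m := by
            simp only [mul_assoc]
        _ = (PP c m * ZZ x y i m) * (c m * x m) := by rw [cz]; simp only [mul_assoc]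
        _ = (r ^ ((m : ℤ) - 2 * i) * r⁻¹) • (ZZ x y i m * (PP c m * x m) * c m) := by
            rw [ih, h2 m (by omega)]
            simp only [mul_smul_comm, smul_mul_assoc, smul_smul, mul_assoc]
            rw [mul_comm r⁻¹]
        _ = _ := by
            rw [px, ← zpow_sub_one₀ hr]; simp only [mul_assoc]; congr 2; ring
    cases i with
    | zero =>
      rw [ZZ, PP, ky]; push_cast; rfl
    | succ i =>
      rw [ZZ, PP, mul_add, ky, kx, add_mul, smul_add]; push_cast; rfl

def SS (t : K) (x y : ℕ → A) (m : ℕ) : A := ∑ i ∈ Finset.range (m + 1), t ^ i • ZZ x y i m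

theorem SS_succ (t : K) (x y : ℕ → A) (m : ℕ) :
    SS t x y (m + 1) = SS t x y m * (y m + t • x m) := by
  have e : SS t x y m = ∑ i ∈ Finset.range (m + 2), t ^ i • ZZ x y i m := by
    rw [Finset.sum_range_succ, ZZ_zero x y m (m+1) (by omega), smul_zero, add_zero, SS]
  rw [mul_add]
  conv_rhs => enter [1]; rw [e]
  rw [SS, SS, Finset.sum_range_succ', Finset.sum_range_succ' _ (m+1)]
  simp only [ZZ, smul_add, Finset.sum_add_distrib, add_mul, Finset.sum_mul, smul_mul_assoc,
    mul_smul_comm, pow_succ]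
  have : ∀ i, t ^ i * t = t * t ^ i := fun i => mul_comm _ _
  simp only [Finset.smul_sum, smul_smul, this]
  abel

theorem PQ (s t : K) (a b x y : ℕ → A) : ∀ (m : ℕ) (_ : ∀ j < m, a j * b j = s • (y j + t • x j))
    (_ : ∀ i < m, ∀ j < m, i ≠ j → Commute (a i) (b j)), PP a m * PP b m = s ^ m • SS t x y m
  | 0, _, _ => by simp [PP, SS, ZZ]
  | m + 1, h, h' => by
    have ih := PQ s t a b x y m (fun j hj => h j (by omega))
      (fun i hi j hj => h' i (by omega) j (by omega))
    have c : a m * PP b m = PP b m * a m := PP_comm b (a m) m fun j hj =>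
      h' m (by omega) j (by omega) (by omega)
    calc PP a m * a m * (PP b m * b m) = PP a m * (a m * PP b m) * b m := by simp only [mul_assoc]
      _ = PP a m * PP b m * (a m * b m) := by rw [c]; simp only [mul_assoc]
      _ = _ := by
        rw [ih, h m (by omega), SS_succ]
        simp only [mul_smul_comm, smul_mul_assoc, smul_smul, pow_succ, mul_comm]

theorem serreA (n : ℕ) (hn : 2 ≤ n) (Z : ℕ → A) (U V : A) (f g h w : ℕ → K) (c d : K)
    (h12 : U * V = ∑ i ∈ Finset.range (n + 1), f i • Z i)
    (h21 : V * U = ∑ i ∈ Finset.range (n + 1), g i • Z i)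
    (hz : ∀ i, Z i * U = h i • (U * Z i))
    (hw : ∀ i ≤ n, f i + g i * h i - c * g i = d * w i) (hw0 : w 0 = 0) (hwn : w n = 0) :
    U * U * V + V * U * U = c • (U * V * U) + d • (U * ∑ k : Fin (n - 1), w (k + 1) • Z (k + 1)) := by
  have e : ∑ k : Fin (n - 1), w (k + 1) • Z (k + 1) = ∑ i ∈ Finset.range (n + 1), w i • Z i := by
    obtain ⟨m, rfl⟩ : ∃ m, n = m + 1 := ⟨n - 1, by omega⟩
    rw [Finset.sum_range_succ, hwn, Finset.sum_range_succ', hw0]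
    simp only [zero_smul, add_zero]
    exact Fin.sum_univ_eq_sum_range (fun k => w (k + 1) • Z (k + 1)) m
  rw [e, mul_assoc U U V, mul_assoc U V U, h12, h21]
  simp only [Finset.mul_sum, Finset.sum_mul, Finset.smul_sum, ← Finset.sum_add_distrib]
  refine Finset.sum_congr rfl fun i hi => ?_
  have := hw i (by simpa [Nat.lt_succ_iff] using hi)
  simp only [mul_smul_comm, smul_mul_assoc, hz, smul_smul, ← add_smul]
  congr 1
  linear_combination this

theorem coeff1 (q : K) (hq : q ≠ 0) (hc : q - q⁻¹ ≠ 0) (n i : ℕ) (hi : i ≤ n) :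
    q ^ n * q⁻¹ ^ i + q ^ i * q ^ (2 * (i : ℤ) - n) - (q ^ n + q⁻¹ ^ n) * q ^ i
      = (q⁻¹ - q) * (q ^ i * ((q ^ i - q⁻¹ ^ i) / (q - q⁻¹) * (q ^ (n - i) - q⁻¹ ^ (n - i)))) := by
  obtain ⟨k, rfl⟩ := Nat.exists_eq_add_of_le hi
  have e : (2 * (i : ℤ) - (i + k : ℕ)) = i - k := by push_cast; ring
  rw [e, zpow_sub₀ hq]
  have hc2 : (q⁻¹ - q) / (q - q⁻¹) = -1 := by rw [div_eq_iff hc]; ring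
  have : (q⁻¹ - q) * (q ^ i * ((q ^ i - q⁻¹ ^ i) / (q - q⁻¹) * (q ^ (i + k - i) - q⁻¹ ^ (i + k - i))))
    = (q⁻¹ - q) / (q - q⁻¹) * (q ^ i * ((q ^ i - q⁻¹ ^ i) * (q ^ k - q⁻¹ ^ k))) := by
    rw [Nat.add_sub_cancel_left]; ring
  rw [this, hc2]
  simp only [zpow_natCast, pow_add, inv_pow]
  have := pow_ne_zero i hq
  have := pow_ne_zero k hq
  generalize q ^ i = X at *
  generalize q ^ k = Y at *
  field_simp
  ring

theorem coeff2 (q : K) (hq : q ≠ 0) (hc : q - q⁻¹ ≠ 0) (n i : ℕ) (hi : i ≤ n) :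
    q ^ i + q ^ n * q⁻¹ ^ i * q ^ ((n : ℤ) - 2 * (i : ℤ)) - (q ^ n + q⁻¹ ^ n) * (q ^ n * q⁻¹ ^ i)
      = (q⁻¹ - q) * (q ^ (n - i) * ((q ^ i - q⁻¹ ^ i) / (q - q⁻¹) * (q ^ (n - i) - q⁻¹ ^ (n - i)))) := by
  obtain ⟨k, rfl⟩ := Nat.exists_eq_add_of_le hi
  have e : ((i + k : ℕ) - 2 * (i : ℤ)) = k - i := by push_cast; ring
  rw [e, zpow_sub₀ hq]
  have hc2 : (q⁻¹ - q) / (q - q⁻¹) = -1 := by rw [div_eq_iff hc]; ring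
  have : (q⁻¹ - q) * (q ^ (i + k - i) * ((q ^ i - q⁻¹ ^ i) / (q - q⁻¹) * (q ^ (i + k - i) - q⁻¹ ^ (i + k - i))))
    = (q⁻¹ - q) / (q - q⁻¹) * (q ^ k * ((q ^ i - q⁻¹ ^ i) * (q ^ k - q⁻¹ ^ k))) := by
    rw [Nat.add_sub_cancel_left]; ring
  rw [this, hc2]
  simp only [zpow_natCast, pow_add, inv_pow]
  have := pow_ne_zero i hq
  have := pow_ne_zero k hq
  generalize q ^ i = X at *
  generalize q ^ k = Y at *
  field_simp
  ring

/-- All relations, for abstract sites. -/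
theorem all_rels (q : K) (hq : q ≠ 0) (hc : q - q⁻¹ ≠ 0) (n : ℕ) (hn : 2 ≤ n) (a b x y : ℕ → A)
    (h1 : ∀ i < n, a i * a i * b i + b i * a i * a i = (q + q⁻¹) • (a i * b i * a i))
    (h2 : ∀ i < n, b i * b i * a i + a i * b i * b i = (q + q⁻¹) • (b i * a i * b i))
    (hx : ∀ i, x i = (q - q⁻¹)⁻¹ • (b i * a i - q⁻¹ • (a i * b i)))
    (hy : ∀ i, y i = (q - q⁻¹)⁻¹ • (a i * b i - q⁻¹ • (b i * a i)))
    (haa : ∀ i < n, ∀ j < n, i ≠ j → a i * a j = a j * a i)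
    (hab : ∀ i < n, ∀ j < n, i ≠ j → a i * b j = b j * a i)
    (hbb : ∀ i < n, ∀ j < n, i ≠ j → b i * b j = b j * b i) :
    (∀ k l, ZZ x y k n * ZZ x y l n = ZZ x y l n * ZZ x y k n) ∧
    (∀ k, PP a n * ZZ x y k n = q ^ ((n : ℤ) - 2 * k) • (ZZ x y k n * PP a n)) ∧
    (∀ k, PP b n * ZZ x y k n = q ^ (2 * (k : ℤ) - n) • (ZZ x y k n * PP b n)) ∧
    (PP a n * PP a n * PP b n + PP b n * PP a n * PP a n
      = (q ^ n + q⁻¹ ^ n) • (PP a n * PP b n * PP a n)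
        + (q⁻¹ - q) • (PP a n * ∑ k : Fin (n - 1), (q ^ ((k : ℕ) + 1) *
          ((q ^ ((k : ℕ) + 1) - q⁻¹ ^ ((k : ℕ) + 1)) / (q - q⁻¹) *
            (q ^ (n - ((k : ℕ) + 1)) - q⁻¹ ^ (n - ((k : ℕ) + 1))))) • ZZ x y ((k : ℕ) + 1) n)) ∧
    (PP b n * PP b n * PP a n + PP a n * PP b n * PP b n
      = (q ^ n + q⁻¹ ^ n) • (PP b n * PP a n * PP b n)
        + (q⁻¹ - q) • (PP b n * ∑ k : Fin (n - 1), (q ^ (n - ((k : ℕ) + 1)) *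
          ((q ^ ((k : ℕ) + 1) - q⁻¹ ^ ((k : ℕ) + 1)) / (q - q⁻¹) *
            (q ^ (n - ((k : ℕ) + 1)) - q⁻¹ ^ (n - ((k : ℕ) + 1))))) • ZZ x y ((k : ℕ) + 1) n)) := by
  have S := fun i hi => site_rels q hq hc (a i) (b i) (x i) (y i) (h1 i hi) (h2 i hi) (hx i) (hy i)
  replace haa : ∀ i < n, ∀ j < n, i ≠ j → Commute (a i) (a j) := haa
  replace hab : ∀ i < n, ∀ j < n, i ≠ j → Commute (a i) (b j) := hab
  replace hbb : ∀ i < n, ∀ j < n, i ≠ j → Commute (b i) (b j) := hbb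
  have hba : ∀ i < n, ∀ j < n, i ≠ j → Commute (b i) (a j) := fun i hi j hj h =>
    (hab j hj i hi h.symm).symm
  have gen : ∀ (t : A) (j : ℕ), Commute t (a j) → Commute t (b j) →
      Commute t (x j) ∧ Commute t (y j) := by
    intro t j ha hb
    rw [hx, hy]
    exact ⟨((hb.mul_right ha).sub_right ((ha.mul_right hb).smul_right _)).smul_right _,
      ((ha.mul_right hb).sub_right ((hb.mul_right ha).smul_right _)).smul_right _⟩
  have hax : ∀ i < n, ∀ j < n, i ≠ j → Commute (a i) (x j) ∧ Commute (a i) (y j) :=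
    fun i hi j hj h => gen _ _ (haa i hi j hj h) (hab i hi j hj h)
  have hbx : ∀ i < n, ∀ j < n, i ≠ j → Commute (b i) (x j) ∧ Commute (b i) (y j) :=
    fun i hi j hj h => gen _ _ (hba i hi j hj h) (hbb i hi j hj h)
  have hxx : ∀ i < n, ∀ j < n, Commute (x i) (x j) ∧ Commute (x i) (y j) := by
    intro i hi j hj
    by_cases h : i = j
    · subst h; exact ⟨Commute.refl _, (S i hi).2.2.2.2.2.2⟩
    · exact gen _ _ (hax j hj i hi (Ne.symm h)).1.symm (hbx j hj i hi (Ne.symm h)).1.symm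
  have hyy : ∀ i < n, ∀ j < n, Commute (y i) (x j) ∧ Commute (y i) (y j) := by
    intro i hi j hj
    by_cases h : i = j
    · subst h; exact ⟨(S i hi).2.2.2.2.2.2.symm, Commute.refl _⟩
    · exact gen _ _ (hax j hj i hi (Ne.symm h)).2.symm (hbx j hj i hi (Ne.symm h)).2.symm
  have P1 := PZ q hq a x y n (fun j hj => (S j hj).1) (fun j hj => (S j hj).2.1) hax
  have P2 : ∀ k, PP b n * ZZ x y k n = q ^ (2 * (k : ℤ) - n) • (ZZ x y k n * PP b n) := by
    intro k
    have := PZ q⁻¹ (inv_ne_zero hq) b x y n (fun j hj => (S j hj).2.2.1)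
      (fun j hj => by rw [inv_inv]; exact (S j hj).2.2.2.1) hbx k
    rw [this, inv_zpow', neg_sub]
  have Q1 := PQ q q⁻¹ a b x y n (fun j hj => (S j hj).2.2.2.2.1) hab
  have Q2 := PQ 1 q b a x y n (fun j hj => by rw [one_smul]; exact (S j hj).2.2.2.2.2.1) hba
  rw [one_pow, one_smul] at Q2
  rw [SS, Finset.smul_sum] at Q1
  simp only [smul_smul] at Q1
  rw [SS] at Q2
  refine ⟨?_, P1, P2, ?_, ?_⟩
  · intro k l
    refine (ZZ_comm x y _ n l fun j hj => ⟨?_, ?_⟩).eq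
    · exact (ZZ_comm x y _ n k fun i hi => hxx j hj i hi).symm
    · exact (ZZ_comm x y _ n k fun i hi => hyy j hj i hi).symm
  · refine serreA n hn (fun i => ZZ x y i n) _ _ _ _ (fun i => q ^ (2 * (i : ℤ) - n))
      (fun i => q ^ i * ((q ^ i - q⁻¹ ^ i) / (q - q⁻¹) * (q ^ (n - i) - q⁻¹ ^ (n - i)))) _ _
      Q1 Q2 ?_ (fun i hi => coeff1 q hq hc n i hi) (by simp) (by simp)
    intro i
    rw [P1, smul_smul, ← zpow_add₀ hq]; simp
  · refine serreA n hn (fun i => ZZ x y i n) _ _ _ _ (fun i => q ^ ((n : ℤ) - 2 * (i : ℤ)))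
      (fun i => q ^ (n - i) * ((q ^ i - q⁻¹ ^ i) / (q - q⁻¹) * (q ^ (n - i) - q⁻¹ ^ (n - i)))) _ _
      Q2 Q1 ?_ (fun i hi => coeff2 q hq hc n i hi) (by simp) (by simp)
    intro i
    rw [P2, smul_smul, ← zpow_add₀ hq]; simp

theorem smul_comm_aux (c d : K) (z w : A) (h : z * w = w * z) :
    (c • z) * (d • w) = (d • w) * (c • z) := by
  rw [smul_mul_smul_comm, smul_mul_smul_comm, h, mul_comm]

theorem smul_qcomm_aux (p c : K) (u z : A) (h : u * z = p • (z * u)) :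
    u * (c • z) = p • ((c • z) * u) := by
  rw [mul_smul_comm, smul_mul_assoc, h, smul_comm]
end Abs

theorem qq_ne_zero : qq ≠ 0 := RatFunc.X_ne_zero

theorem qq_sub_ne_zero : qq - qq⁻¹ ≠ 0 := by
  intro h
  have h2 : qq * qq = 1 := by
    have := sub_eq_zero.mp h
    nth_rewrite 2 [this]
    exact mul_inv_cancel₀ qq_ne_zero
  have h3 : algebraMap (Polynomial ℂ) (RatFunc ℂ) (Polynomial.X * Polynomial.X)
      = algebraMap (Polynomial ℂ) (RatFunc ℂ) 1 := by
    rw [map_mul, RatFunc.algebraMap_X, map_one]; exact h2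
  have h4 := RatFunc.algebraMap_injective ℂ h3
  have h5 := congrArg (Polynomial.eval 0) h4
  simp at h5

theorem Egen_serre (i j : Fin 2) (h : i ≠ j) :
    Egen i * Egen i * Egen j + Egen j * Egen i * Egen i
      = (qq + qq⁻¹) • (Egen i * Egen j * Egen i) := by
  have := RingQuot.mkAlgHom_rel Kq (SL3Rel.serre i j h)
  simp only [map_add, map_mul, map_smul] at this
  exact this

theorem emb_eq (n : ℕ) (x : UqSL3) (k : Fin n) :
    emb n x (k + 1) = PiTensorProduct.singleAlgHom (R := Kq) (A := fun _ : Fin n => UqSL3) k x := by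
  rw [emb]
  show _ = PiTensorProduct.tprod Kq (Pi.mulSingle (M := fun _ : Fin n => UqSL3) k x)
  congr 1
  funext j
  by_cases h : j = k
  · subst h; simp
  · have : (j : ℕ) ≠ k := fun h' => h (Fin.ext h')
    simp [this, h]

theorem emb_comm (n : ℕ) (x y : UqSL3) (i j : ℕ) (h : i ≠ j) : Commute (emb n x i) (emb n y j) := by
  rw [emb, emb]
  apply Commute.tprod
  show _ * _ = _ * _
  funext k
  simp only [Pi.mul_apply]
  split_ifs <;> first | omega | simp

theorem emb_serre (n : ℕ) (i j : Fin 2) (h : i ≠ j) (k : ℕ) (hk : k < n) :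
    emb n (Egen i) (k+1) * emb n (Egen i) (k+1) * emb n (Egen j) (k+1)
      + emb n (Egen j) (k+1) * emb n (Egen i) (k+1) * emb n (Egen i) (k+1)
      = (qq + qq⁻¹) • (emb n (Egen i) (k+1) * emb n (Egen j) (k+1) * emb n (Egen i) (k+1)) := by
  have e := fun x => emb_eq n x ⟨k, hk⟩
  simp only at e
  simp only [e, ← map_mul, ← map_add, ← map_smul, Egen_serre i j h]

theorem prod_PP {A : Type*} [Ring A] (n : ℕ) (a : ℕ → A) :
    (List.ofFn fun j : Fin n => a j).prod = PP a n := by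
  induction n with
  | zero => simp [PP]
  | succ m ih =>
    rw [List.ofFn_succ_last, List.prod_append, PP, ← ih]
    simp

theorem Zel_eq (n : ℕ) : ∀ k i, Zel n i (k + 1)
    = ZZ (fun j => E12i n (j + 1)) (fun j => E21i n (j + 1)) i (k + 1)
  | 0, 0 => by simp [Zel, ZZ]
  | 0, 1 => by simp [Zel, ZZ]
  | 0, _ + 2 => by simp [Zel, ZZ]
  | k + 1, 0 => by rw [Zel, ZZ, Zel_eq n k 0]
  | k + 1, i + 1 => by rw [Zel, ZZ, Zel_eq n k (i + 1), Zel_eq n k i]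

/-- **The structural homomorphism `𝒜^{(n)}_{q,3} → U_q^+(sl₃)^{⊗n}`** (diagonal folding
`(sl₃^{×n}, sl₃)`): the assignment `u₁ ↦ Y_{1,n}`, `u₂ ↦ Y_{2,n}`,
`z_k ↦ [k]_q (q^{n−k} − q^{k−n}) Z_{k,n}` extends to an algebra homomorphism. -/
theorem aqn_to_tensor_homomorphism (n : ℕ) (hn : 2 ≤ n) :
    ∃ f : Aqn n →ₐ[Kq] TP n,
      f (RingQuot.mkAlgHom Kq (ARel n) (au1 n)) = Y1 n ∧
      f (RingQuot.mkAlgHom Kq (ARel n) (au2 n)) = Y2 n ∧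
      ∀ k : Fin (n - 1),
        f (RingQuot.mkAlgHom Kq (ARel n) (az n k))
          = (qint ((k : ℕ) + 1) * (qq ^ (n - ((k : ℕ) + 1)) - qq⁻¹ ^ (n - ((k : ℕ) + 1)))) •
              Zel n ((k : ℕ) + 1) n := by
  obtain ⟨R1, R2, R3, R4, R5⟩ := all_rels (A := TP n) qq qq_ne_zero qq_sub_ne_zero n hn
    (fun j => E1i n (j + 1)) (fun j => E2i n (j + 1))
    (fun j => E12i n (j + 1)) (fun j => E21i n (j + 1))
    (fun k hk => emb_serre n 0 1 (by decide) k hk)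
    (fun k hk => emb_serre n 1 0 (by decide) k hk)
    (fun _ => rfl) (fun _ => rfl)
    (fun i _ j _ h => (emb_comm n (Egen 0) (Egen 0) (i + 1) (j + 1) (by omega)).eq)
    (fun i _ j _ h => (emb_comm n (Egen 0) (Egen 1) (i + 1) (j + 1) (by omega)).eq)
    (fun i _ j _ h => (emb_comm n (Egen 1) (Egen 1) (i + 1) (j + 1) (by omega)).eq)
  have hZ : ∀ i, ZZ (fun j => E12i n (j + 1)) (fun j => E21i n (j + 1)) i n = Zel n i n := by
    intro i
    obtain ⟨m, rfl⟩ : ∃ m, n = m + 1 := ⟨n - 1, by omega⟩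
    exact (Zel_eq (m + 1) m i).symm
  have hY1 : PP (fun j => E1i n (j + 1)) n = Y1 n := (prod_PP n fun j => E1i n (j + 1)).symm
  have hY2 : PP (fun j => E2i n (j + 1)) n = Y2 n := (prod_PP n fun j => E2i n (j + 1)).symm
  simp only [hZ, hY1, hY2] at R1 R2 R3 R4 R5
  let F : FreeAlgebra Kq (AGen n) →ₐ[Kq] TP n := FreeAlgebra.lift Kq (fun g => match g with
    | AGen.u1 => Y1 n
    | AGen.u2 => Y2 n
    | AGen.z k => (qint ((k : ℕ) + 1) * (qq ^ (n - ((k : ℕ) + 1)) - qq⁻¹ ^ (n - ((k : ℕ) + 1)))) •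
              Zel n ((k : ℕ) + 1) n)
  have F1 : F (au1 n) = Y1 n := FreeAlgebra.lift_ι_apply _ _
  have F2 : F (au2 n) = Y2 n := FreeAlgebra.lift_ι_apply _ _
  have F3 : ∀ k, F (az n k) = (qint ((k : ℕ) + 1) *
      (qq ^ (n - ((k : ℕ) + 1)) - qq⁻¹ ^ (n - ((k : ℕ) + 1)))) • Zel n ((k : ℕ) + 1) n :=
    fun k => FreeAlgebra.lift_ι_apply _ _
  have H : ∀ ⦃x y⦄, ARel n x y → F x = F y := by
    intro x y h
    cases h with
    | comm_z k l =>
      rw [map_mul, map_mul, F3, F3]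
      exact smul_comm_aux (K := Kq) (A := TP n) _ _ _ _ (R1 ((k : ℕ) + 1) ((l : ℕ) + 1))
    | u1z k =>
      rw [map_smul, map_mul, map_mul, F1, F3]
      have := R2 ((k : ℕ) + 1)
      push_cast at this
      exact smul_qcomm_aux _ _ _ _ this
    | u2z k l hkl =>
      rw [map_smul, map_mul, map_mul, F2, F3]
      have := R3 ((l : ℕ) + 1)
      have e : 2 * (((l : ℕ) + 1 : ℕ) : ℤ) - n = (n : ℤ) - 2 * ((k : ℕ) + 1) := by omega
      rw [e] at this
      exact smul_qcomm_aux _ _ _ _ this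
    | serre1 =>
      simp only [map_add, map_mul, map_smul, map_sum, F1, F2, F3, smul_smul]
      exact R4
    | serre2 =>
      simp only [map_add, map_mul, map_smul, map_sum, F1, F2, F3, smul_smul]
      exact R5
  refine ⟨RingQuot.liftAlgHom Kq ⟨F, H⟩, ?_, ?_, ?_⟩
  · rw [RingQuot.liftAlgHom_mkAlgHom_apply, F1]
  · rw [RingQuot.liftAlgHom_mkAlgHom_apply, F2]
  · intro k
    rw [RingQuot.liftAlgHom_mkAlgHom_apply, F3]

end
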